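/- Let k and l be nonnegative integers with k ≤ l. The set of P-positions of the game W_{k,l} is identical to the set of P-positions of the game W_l, namely {(i,i) : 0 ≤ i < l} ∪ {(A_n + l, B_n + l) : n ≥ 0} ∪ {(B_n + l, A_n + l) : n ≥ 0}. -/

import Mathlib

noncomputable def phi : ℝ := (1 + Real.sqrt 5) / 2
noncomputable def wA (n : ℕ) : ℕ := ⌊phi * n⌋₊
noncomputable def wB (n : ℕ) : ℕ := ⌊phi ^ 2 * n⌋₊

/-- A legal move in the game `W_k` from `p` to `q`: a Nim move, or a diagonal move
whose resulting smaller entry is at least `k`. -/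
def WkMove (k : ℕ) (p q : ℕ × ℕ) : Prop :=
  (∃ t, 1 ≤ t ∧ t ≤ p.1 ∧ q = (p.1 - t, p.2)) ∨
  (∃ t, 1 ≤ t ∧ t ≤ p.2 ∧ q = (p.1, p.2 - t)) ∨
  (∃ s, 1 ≤ s ∧ s ≤ min p.1 p.2 ∧ k ≤ min (p.1 - s) (p.2 - s) ∧ q = (p.1 - s, p.2 - s))

/-- `S` is the set of P-positions of the game with move relation `move`. -/
def IsPPositions (move : ℕ × ℕ → ℕ × ℕ → Prop) (S : Set (ℕ × ℕ)) : Prop :=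
  (∀ p ∈ S, ∀ q ∈ S, ¬ move p q) ∧ (∀ p ∉ S, ∃ q ∈ S, move p q)

/-- `G` is the Sprague–Grundy function of the game with move relation `move`:
at every position, `G` takes the mex of the values of the options. -/
def IsGrundy (move : ℕ × ℕ → ℕ × ℕ → Prop) (G : ℕ × ℕ → ℕ) : Prop :=
  ∀ p, (∀ q, move p q → G q ≠ G p) ∧ (∀ v, v < G p → ∃ q, move p q ∧ G q = v)

/-- A legal move in the game `W_{k,l}` from `p` to `q`: a Nim move, or a diagonal move
whose resulting smaller entry is at least `k` and resulting larger entry is at least `l`. -/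
def WklMove (k l : ℕ) (p q : ℕ × ℕ) : Prop :=
  (∃ t, 1 ≤ t ∧ t ≤ p.1 ∧ q = (p.1 - t, p.2)) ∨
  (∃ t, 1 ≤ t ∧ t ≤ p.2 ∧ q = (p.1, p.2 - t)) ∨
  (∃ s, 1 ≤ s ∧ s ≤ min p.1 p.2 ∧ k ≤ min (p.1 - s) (p.2 - s) ∧
    l ≤ max (p.1 - s) (p.2 - s) ∧ q = (p.1 - s, p.2 - s))

/-- A game in which every move decreases `p.1 + p.2` has at most one set of P-positions. -/
theorem IsPPositions.unique {move : ℕ × ℕ → ℕ × ℕ → Prop}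
    (hmove : ∀ p q, move p q → q.1 + q.2 < p.1 + p.2) {S T : Set (ℕ × ℕ)}
    (hS : IsPPositions move S) (hT : IsPPositions move T) : S = T := by
  have key : ∀ N : ℕ, ∀ p : ℕ × ℕ, p.1 + p.2 = N → (p ∈ S ↔ p ∈ T) := by
    intro N
    induction N using Nat.strong_induction_on with
    | _ N ih =>
      intro p hp
      constructor
      · intro h
        by_contra hn
        obtain ⟨q, hq, hpq⟩ := hT.2 p hn
        exact hS.1 p h q ((ih _ (hp ▸ hmove p q hpq) q rfl).2 hq) hpq
      · intro h
        by_contra hn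
        obtain ⟨q, hq, hpq⟩ := hS.2 p hn
        exact hT.1 p h q ((ih _ (hp ▸ hmove p q hpq) q rfl).1 hq) hpq
  ext p
  exact key _ p rfl

theorem one_lt_phi : 1 < phi := Real.one_lt_goldenRatio

theorem phi_sq : phi ^ 2 = phi + 1 := Real.goldenRatio_sq

theorem phi_irrational : Irrational phi := Real.goldenRatio_irrational

theorem phi_holderConjugate : phi.HolderConjugate (phi ^ 2) := by
  have h := one_lt_phi
  rw [Real.holderConjugate_iff]
  refine ⟨h, ?_⟩
  field_simp
  linarith [phi_sq]

theorem wB_eq (n : ℕ) : wB n = wA n + n := by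
  unfold wA wB
  rw [phi_sq, add_mul, one_mul, Nat.floor_add_natCast]
  have := one_lt_phi
  positivity

theorem wA_strictMono : StrictMono wA := by
  refine strictMono_nat_of_lt_succ fun n => ?_
  have h := one_lt_phi
  have h0 : 0 ≤ phi * n := by positivity
  unfold wA
  rw [Nat.lt_iff_add_one_le, ← Nat.floor_add_one h0]
  apply Nat.floor_le_floor
  push_cast
  linarith

theorem wA_zero : wA 0 = 0 := by simp [wA]

theorem wB_zero : wB 0 = 0 := by simp [wB]

theorem wB_strictMono : StrictMono wB := fun m n h => by
  have := wA_strictMono h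
  rw [wB_eq, wB_eq]
  omega

theorem beattySeq_phi (n : ℕ) : beattySeq phi n = wA n := by
  have := one_lt_phi
  rw [beattySeq, wA, Int.natCast_floor_eq_floor (by positivity), mul_comm, Int.cast_natCast]

theorem beattySeq_phi_sq (n : ℕ) : beattySeq (phi ^ 2) n = wB n := by
  rw [beattySeq, wB, Int.natCast_floor_eq_floor (by positivity), mul_comm, Int.cast_natCast]

theorem exists_wA_or_wB (m : ℕ) : (∃ n, wA n = m) ∨ ∃ n, wB n = m := by
  rcases Nat.eq_zero_or_pos m with rfl | hm
  · exact Or.inl ⟨0, wA_zero⟩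
  have h : (m : ℤ) ∈ {n : ℤ | 0 < n} := by simpa using hm
  rw [← phi_irrational.beattySeq_symmDiff_beattySeq_pos phi_holderConjugate] at h
  rcases h with ⟨⟨k, hk, hkm⟩, -⟩ | ⟨⟨k, hk, hkm⟩, -⟩
  · lift k to ℕ using hk.le
    rw [beattySeq_phi] at hkm
    exact Or.inl ⟨k, by exact_mod_cast hkm⟩
  · lift k to ℕ using hk.le
    rw [beattySeq_phi_sq] at hkm
    exact Or.inr ⟨k, by exact_mod_cast hkm⟩

theorem eq_zero_of_wA_eq_wB {m n : ℕ} (h : wA m = wB n) : m = 0 ∧ n = 0 := by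
  rcases Nat.eq_zero_or_pos m with rfl | hm
  · rw [wA_zero, wB_eq] at h
    omega
  rcases Nat.eq_zero_or_pos n with rfl | hn
  · have := wA_strictMono hm
    rw [wB_zero] at h
    omega
  exfalso
  have hpos : (wA m : ℤ) ∈ {n : ℤ | 0 < n} := by
    have := wA_strictMono hm
    simp only [Set.mem_ofPred_eq]
    omega
  rw [← phi_irrational.beattySeq_symmDiff_beattySeq_pos phi_holderConjugate] at hpos
  have hA : (wA m : ℤ) ∈ {x | ∃ k > 0, beattySeq phi k = x} :=
    ⟨m, by exact_mod_cast hm, beattySeq_phi m⟩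
  have hB : (wA m : ℤ) ∈ {x | ∃ k > 0, beattySeq (phi ^ 2) k = x} :=
    ⟨n, by exact_mod_cast hn, by rw [beattySeq_phi_sq, h]⟩
  rcases hpos with ⟨-, h'⟩ | ⟨-, h'⟩
  · exact h' hB
  · exact h' hA

/-- The P-positions of Wythoff's game shifted by `(l, l)`, together with the diagonal below `l`. -/
def shiftedWythoffSet (l : ℕ) : Set (ℕ × ℕ) :=
  {p : ℕ × ℕ | ∃ i, i < l ∧ p = (i, i)} ∪
    {p : ℕ × ℕ | ∃ n, p = (wA n + l, wB n + l)} ∪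
    {p : ℕ × ℕ | ∃ n, p = (wB n + l, wA n + l)}

theorem mem_shiftedWythoffSet {l a b : ℕ} :
    (a, b) ∈ shiftedWythoffSet l ↔ (a < l ∧ a = b) ∨ (∃ n, a = wA n + l ∧ b = wB n + l) ∨
      ∃ n, a = wB n + l ∧ b = wA n + l := by
  simp only [shiftedWythoffSet, Set.mem_union, Set.mem_ofPred_eq, Prod.mk.injEq, or_assoc]
  refine or_congr_left ⟨?_, ?_⟩
  · rintro ⟨i, hi, rfl, rfl⟩
    exact ⟨hi, rfl⟩
  · rintro ⟨h, rfl⟩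
    exact ⟨a, h, rfl, rfl⟩

theorem swap_mem_shiftedWythoffSet {l a b : ℕ} (h : (a, b) ∈ shiftedWythoffSet l) :
    (b, a) ∈ shiftedWythoffSet l := by
  rw [mem_shiftedWythoffSet] at h ⊢
  rcases h with ⟨h, rfl⟩ | ⟨n, h⟩ | ⟨n, h⟩
  · exact Or.inl ⟨h, rfl⟩
  · exact Or.inr (Or.inr ⟨n, h.symm⟩)
  · exact Or.inr (Or.inl ⟨n, h.symm⟩)

theorem snd_eq_of_mem_shiftedWythoffSet {l a b c : ℕ} (hb : (a, b) ∈ shiftedWythoffSet l)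
    (hc : (a, c) ∈ shiftedWythoffSet l) : b = c := by
  rw [mem_shiftedWythoffSet] at hb hc
  rcases hb with ⟨hb, rfl⟩ | ⟨n, rfl, rfl⟩ | ⟨n, rfl, rfl⟩ <;>
    rcases hc with ⟨hc, rfl⟩ | ⟨m, hm, rfl⟩ | ⟨m, hm, rfl⟩
  · rfl
  · omega
  · omega
  · omega
  · rw [wA_strictMono.injective (Nat.add_right_cancel hm)]
  · obtain ⟨rfl, rfl⟩ := eq_zero_of_wA_eq_wB (Nat.add_right_cancel hm)
    rw [wA_zero, wB_zero]
  · omega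
  · obtain ⟨rfl, rfl⟩ := eq_zero_of_wA_eq_wB (Nat.add_right_cancel hm.symm)
    rw [wA_zero, wB_zero]
  · rw [wB_strictMono.injective (Nat.add_right_cancel hm)]

theorem eq_zero_of_diagonal_mem_shiftedWythoffSet {l a b s : ℕ}
    (h : (a, b) ∈ shiftedWythoffSet l) (hs : (a + s, b + s) ∈ shiftedWythoffSet l)
    (hl : l ≤ max a b) : s = 0 := by
  rw [mem_shiftedWythoffSet] at h hs
  rcases h with ⟨h, rfl⟩ | ⟨n, rfl, rfl⟩ | ⟨n, rfl, rfl⟩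
  · omega
  all_goals
    have hn := wB_eq n
    rcases hs with ⟨hs, hs'⟩ | ⟨m, hm, hm'⟩ | ⟨m, hm, hm'⟩
    · omega
    all_goals
      have hBm := wB_eq m
      obtain rfl : m = n := by omega
      omega

theorem WklMove.sum_lt {k l : ℕ} {p q : ℕ × ℕ} (h : WklMove k l p q) :
    q.1 + q.2 < p.1 + p.2 := by
  rcases h with ⟨t, h1, h2, rfl⟩ | ⟨t, h1, h2, rfl⟩ | ⟨t, h1, h2, -, -, rfl⟩ <;> dsimp only <;> omega

theorem WklMove.swap {k l a b c d : ℕ} (h : WklMove k l (a, b) (c, d)) :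
    WklMove k l (b, a) (d, c) := by
  rcases h with ⟨t, h1, h2, h3⟩ | ⟨t, h1, h2, h3⟩ | ⟨t, h1, h2, h3, h4, h5⟩
  · exact Or.inr (Or.inl ⟨t, h1, h2, by simp_all⟩)
  · exact Or.inl ⟨t, h1, h2, by simp_all⟩
  · exact Or.inr (Or.inr ⟨t, h1, by rwa [min_comm], by rwa [min_comm], by rwa [max_comm],
      by simp_all⟩)

theorem WklMove.of_snd_lt {k l a b c : ℕ} (h : c < b) : WklMove k l (a, b) (a, c) :=
  Or.inr (Or.inl ⟨b - c, by omega, by dsimp only; omega, by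
    dsimp only; rw [Nat.sub_sub_self h.le]⟩)

theorem exists_WklMove_of_le {k l a b : ℕ} (hkl : k ≤ l) (hab : a ≤ b)
    (h : (a, b) ∉ shiftedWythoffSet l) : ∃ q ∈ shiftedWythoffSet l, WklMove k l (a, b) q := by
  rcases lt_or_ge a l with ha | ha
  · have hne : a ≠ b := fun he => h (mem_shiftedWythoffSet.2 (Or.inl ⟨ha, he⟩))
    exact ⟨(a, a), mem_shiftedWythoffSet.2 (Or.inl ⟨ha, rfl⟩), .of_snd_lt (by omega)⟩
  obtain ⟨c, rfl⟩ := Nat.exists_eq_add_of_le' ha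
  rcases exists_wA_or_wB c with ⟨n, rfl⟩ | ⟨n, rfl⟩
  · have hmem : (wA n + l, wB n + l) ∈ shiftedWythoffSet l :=
      mem_shiftedWythoffSet.2 (Or.inr (Or.inl ⟨n, rfl, rfl⟩))
    rcases lt_trichotomy b (wB n + l) with hb | rfl | hb
    · obtain ⟨d, rfl⟩ := Nat.exists_eq_add_of_le hab
      have hn := wB_eq n
      have hd := wB_eq d
      have hlt := wA_strictMono (show d < n by omega)
      refine ⟨(wA d + l, wB d + l), mem_shiftedWythoffSet.2 (Or.inr (Or.inl ⟨d, rfl, rfl⟩)),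
        Or.inr (Or.inr ⟨wA n - wA d, ?_, ?_, ?_, ?_, ?_⟩)⟩
      · omega
      · dsimp only
        omega
      · dsimp only
        omega
      · dsimp only
        omega
      · ext <;> dsimp only <;> omega
    · exact absurd hmem h
    · exact ⟨_, hmem, .of_snd_lt hb⟩
  · have hmem : (wB n + l, wA n + l) ∈ shiftedWythoffSet l :=
      mem_shiftedWythoffSet.2 (Or.inr (Or.inr ⟨n, rfl, rfl⟩))
    have hne : b ≠ wA n + l := fun he => h (he ▸ hmem)
    have hn := wB_eq n
    exact ⟨_, hmem, .of_snd_lt (by omega)⟩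

theorem isPPositions_WklMove_shiftedWythoffSet {k l : ℕ} (hkl : k ≤ l) :
    IsPPositions (WklMove k l) (shiftedWythoffSet l) := by
  constructor
  · rintro ⟨a, b⟩ hp q hq (⟨t, h1, h2, rfl⟩ | ⟨t, h1, h2, rfl⟩ | ⟨t, h1, h2, -, h4, rfl⟩) <;>
      dsimp only at *
    · have := snd_eq_of_mem_shiftedWythoffSet (swap_mem_shiftedWythoffSet hp)
        (swap_mem_shiftedWythoffSet hq)
      omega
    · have := snd_eq_of_mem_shiftedWythoffSet hp hq
      omega
    · have ha : a - t + t = a := by omega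
      have hb : b - t + t = b := by omega
      have := eq_zero_of_diagonal_mem_shiftedWythoffSet (s := t) hq (by rwa [ha, hb]) h4
      omega
  · rintro ⟨a, b⟩ hp
    rcases le_total a b with hab | hab
    · exact exists_WklMove_of_le hkl hab hp
    · obtain ⟨⟨c, d⟩, hq, hmove⟩ :=
        exists_WklMove_of_le hkl hab fun h => hp (swap_mem_shiftedWythoffSet h)
      exact ⟨(d, c), swap_mem_shiftedWythoffSet hq, hmove.swap⟩

theorem isPPositions_WklMove_iff {k l : ℕ} (hkl : k ≤ l) (S : Set (ℕ × ℕ)) :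
    IsPPositions (WklMove k l) S ↔ S = shiftedWythoffSet l :=
  ⟨fun h => h.unique (fun _ _ => WklMove.sum_lt) (isPPositions_WklMove_shiftedWythoffSet hkl),
    fun h => h ▸ isPPositions_WklMove_shiftedWythoffSet hkl⟩

theorem WkMove_eq_WklMove (l : ℕ) : WkMove l = WklMove l l := by
  funext p q
  refine propext (or_congr_right (or_congr_right (exists_congr fun s => ?_)))
  have : l ≤ min (p.1 - s) (p.2 - s) → l ≤ max (p.1 - s) (p.2 - s) := fun h => h.trans min_le_max
  tauto

theorem Wkl_P_positions (k l : ℕ) (hkl : k ≤ l) :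
    (∀ S : Set (ℕ × ℕ), IsPPositions (WklMove k l) S ↔
      S = {p : ℕ × ℕ | ∃ i, i < l ∧ p = (i, i)} ∪
          {p : ℕ × ℕ | ∃ n, p = (wA n + l, wB n + l)} ∪
          {p : ℕ × ℕ | ∃ n, p = (wB n + l, wA n + l)}) ∧
    (∀ S : Set (ℕ × ℕ), IsPPositions (WkMove l) S ↔
      S = {p : ℕ × ℕ | ∃ i, i < l ∧ p = (i, i)} ∪
          {p : ℕ × ℕ | ∃ n, p = (wA n + l, wB n + l)} ∪
          {p : ℕ × ℕ | ∃ n, p = (wB n + l, wA n + l)}) := by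
  rw [WkMove_eq_WklMove]
  exact ⟨isPPositions_WklMove_iff hkl, isPPositions_WklMove_iff le_rfl⟩
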